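/- Let K be a field of characteristic zero, let α and β be nonzero elements of K, and let a, b, c, d be positive integers with a·d > b·c. In the polynomial ring R = K[x0, x1, y0, y1], consider F = (x0 + x1·t)^a − α·(y0 + y1·t)^b and G = (x0 + x1·t)^c − β·(y0 + y1·t)^d as polynomials in t with coefficients in R, and let r = Res_t(F, G) ∈ R be their resultant. Then (x0·y1 − x1·y0)^{bc} divides r, but (x0·y1 − x1·y0)^{bc+1} does not divide r; i.e. the bracket x0·y1 − x1·y0 appears with exponent exactly b·c in the factorization of r. -/

import Mathlib

open Polynomial

/-- The Sylvester matrix of two univariate polynomials `p` and `q`, regarded as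
polynomials of degree (at most) `m` and `n` respectively: a square matrix of size
`n + m`, whose first `n` rows are the shifted coefficient sequences of `p` and whose
last `m` rows are the shifted coefficient sequences of `q`. -/
def sylvesterMatrix {R : Type*} [CommRing R] (m n : ℕ) (p q : R[X]) :
    Matrix (Fin (n + m)) (Fin (n + m)) R :=
  Matrix.of fun i j =>
    if (i : ℕ) < n then
      (if (i : ℕ) ≤ (j : ℕ) then p.coeff ((j : ℕ) - (i : ℕ)) else 0)
    else
      (if (i : ℕ) - n ≤ (j : ℕ) then q.coeff ((j : ℕ) - ((i : ℕ) - n)) else 0)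

/-- The Sylvester resultant of two univariate polynomials `p` and `q` of degrees
(at most) `m` and `n`: the determinant of their Sylvester matrix. -/
def sylvesterResultant {R : Type*} [CommRing R] (m n : ℕ) (p q : R[X]) : R :=
  (sylvesterMatrix m n p q).det

section

open IsLocalRing

lemma sylvesterResultant_eq_resultant {R : Type*} [CommRing R] (m n : ℕ) (p q : R[X])
    (hp : p.natDegree ≤ m) (hq : q.natDegree ≤ n) :
    sylvesterResultant m n p q = resultant q p n m := by
  rw [sylvesterResultant, resultant, ← Matrix.det_transpose]
  congr 1
  ext i j
  induction j using Fin.addCases with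
  | left j =>
    simp only [Matrix.transpose_apply, sylvesterMatrix, sylvester, Matrix.of_apply,
      Fin.addCases_left, Fin.val_castAdd, j.isLt, if_true, Set.mem_Icc]
    split_ifs with h h' h' <;> first | rfl | omega | skip
    exact coeff_eq_zero_of_natDegree_lt (by omega)
  | right j =>
    simp only [Matrix.transpose_apply, sylvesterMatrix, sylvester, Matrix.of_apply,
      Fin.addCases_right, Fin.val_natAdd, Set.mem_Icc]
    rw [if_neg (by omega)]
    simp only [Nat.add_sub_cancel_left]
    split_ifs with h h' h' <;> first | rfl | omega | skip
    exact coeff_eq_zero_of_natDegree_lt (by omega)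

/-- Every prime of a domain contained in a field is the centre of a valuation of that field. -/
lemma exists_valuationSubring_center {R L : Type*} [CommRing R] [Field L] (f : R →+* L)
    (hf : Function.Injective f) (P : Ideal R) [P.IsPrime] :
    ∃ (O : ValuationSubring L) (φ : R →+* O), (∀ r, (φ r : L) = f r) ∧
      ∀ r, IsUnit (φ r) ↔ r ∉ P := by
  have hu : ∀ y : P.primeCompl, IsUnit (f y) := fun y =>
    isUnit_iff_ne_zero.mpr fun h => y.2 <| by
      rw [(map_eq_zero_iff f hf).mp h]; exact P.zero_mem
  let g : Localization.AtPrime P →+* L := IsLocalization.lift hu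
  obtain ⟨O, hO, hloc⟩ := IsLocalRing.exists_factor_valuationRing g
  let ψ : Localization.AtPrime P →+* O := g.codRestrict O.toSubring hO
  have hψ : IsLocalHom ψ := hloc
  refine ⟨O, ψ.comp (algebraMap R _), fun r => ?_, fun r => ?_⟩
  · exact IsLocalization.lift_eq hu r
  · rw [RingHom.comp_apply, isUnit_map_iff ψ]
    exact IsLocalization.AtPrime.isUnit_to_map_iff _ P r

/-- Eliminating `u` and `w` from two binomial equations and a linear relation. -/
lemma binomial_elimination {k : Type*} [Field k] {a b c d : ℕ} (h : b * c < a * d)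
    {u w x y α β : k} (hw : w ≠ 0) (hlin : u * y = x * w)
    (h₁ : u ^ a = α * w ^ b) (h₂ : u ^ c = β * w ^ d) :
    x ^ (a * d - b * c) * (α ^ c * β ^ b) = y ^ (a * d - b * c) * (α ^ d * β ^ a) := by
  set M := a * d - b * c with hM
  have hadd : a * d = M + b * c := by omega
  have hu' : u ^ M * β ^ b = α ^ d := by
    have h1 : u ^ (a * d) = α ^ d * w ^ (b * d) := by
      rw [pow_mul, h₁, mul_pow, ← pow_mul]
    have h2 : u ^ (b * c) = β ^ b * w ^ (b * d) := by
      rw [mul_comm b c, pow_mul, h₂, mul_pow, ← pow_mul, mul_comm d b]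
    rw [hadd, pow_add, h2] at h1
    exact mul_right_cancel₀ (pow_ne_zero (b * d) hw) (by linear_combination h1)
  have hw' : w ^ M * β ^ a = α ^ c := by
    have h1 : u ^ (a * c) = α ^ c * w ^ (b * c) := by
      rw [pow_mul, h₁, mul_pow, ← pow_mul]
    have h2 : u ^ (a * c) = β ^ a * (w ^ M * w ^ (b * c)) := by
      rw [mul_comm a c, pow_mul, h₂, mul_pow, ← pow_mul, mul_comm d a, hadd, pow_add]
    exact mul_right_cancel₀ (pow_ne_zero (b * c) hw) (by linear_combination h1 - h2)
  have h3 := congrArg (· ^ M) hlin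
  simp only [mul_pow] at h3
  rw [← hu', ← hw']
  linear_combination (-β ^ a * β ^ b) * h3

section Valuation

variable {L : Type*} [Field L] (O : ValuationSubring L)

/-- The value of the second binomial at a zero of the first. -/
lemma valuation_binomial_pow {a b c d : ℕ} (ha : 0 < a) (hb : 0 < b)
    (h : b * c < a * d) {u w x y α β D : O} (hα : IsUnit α)
    (hβ : IsUnit β) (hD : ¬ IsUnit D) (hD0 : D ≠ 0) (hlin : u * y = x * w + D)
    (hind : IsUnit (x ^ (a * d - b * c) * (α ^ c * β ^ b) -
      y ^ (a * d - b * c) * (α ^ d * β ^ a)))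
    (h₁ : u ^ a = α * w ^ b) :
    O.valuation ((u ^ c - β * w ^ d : O) : L) ^ a = O.valuation (w : L) ^ (b * c) := by
  have hvα := (O.valuation_eq_one_iff α).mp hα
  have hvβ := (O.valuation_eq_one_iff β).mp hβ
  have hv : O.valuation (u : L) ^ a = O.valuation (w : L) ^ b := by
    have := congrArg (fun z : O => O.valuation (z : L)) h₁
    simpa [hvα] using this
  rcases O.valuation_lt_one_or_eq_one w with hw | hw
  · have hw0 : w ≠ 0 := by
      rintro rfl
      have hu0 : u = 0 := by
        apply pow_eq_zero_iff ha.ne' |>.mp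
        rw [h₁, zero_pow hb.ne', mul_zero]
      apply hD0
      simpa [hu0] using hlin.symm
    have hwpos : 0 < O.valuation (w : L) := by
      rw [Valuation.pos_iff]
      simpa using hw0
    have hlt : O.valuation ((β * w ^ d : O) : L) < O.valuation ((u ^ c : O) : L) := by
      have : (O.valuation (w : L) ^ d) ^ a < (O.valuation (u : L) ^ c) ^ a := by
        rw [← pow_mul, ← pow_mul, mul_comm c a, pow_mul _ a c, hv, ← pow_mul, mul_comm d a]
        exact pow_lt_pow_right_of_lt_one₀ hwpos hw h
      simpa [hvβ] using lt_of_pow_lt_pow_left₀ a zero_le this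
    have hlt' : O.valuation ((u ^ c - β * w ^ d : O) : L) = O.valuation ((u ^ c : O) : L) := by
      rw [AddSubgroupClass.coe_sub]
      exact Valuation.map_sub_eq_of_lt_left _ hlt
    rw [hlt', SubmonoidClass.coe_pow, map_pow, ← pow_mul, mul_comm c a, pow_mul, hv, ← pow_mul]
  · rw [hw, one_pow]
    have hunit : IsUnit (u ^ c - β * w ^ d) := by
      by_contra hnu
      have e₂ : residue O (u ^ c - β * w ^ d) = 0 := (residue_eq_zero_iff _).mpr hnu
      have eD : residue O D = 0 := (residue_eq_zero_iff _).mpr hD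
      have ew : residue O w ≠ 0 :=
        (residue_ne_zero_iff_isUnit w).mpr ((O.valuation_eq_one_iff w).mpr hw)
      have elin := congrArg (residue O) hlin
      have e₁ := congrArg (residue O) h₁
      simp only [map_mul, map_add, map_pow, map_sub, eD, add_zero] at elin e₁ e₂
      have := binomial_elimination h ew elin e₁ (sub_eq_zero.mp e₂)
      refine (residue_ne_zero_iff_isUnit _).mpr hind ?_
      simpa [sub_eq_zero] using this
    rw [(O.valuation_eq_one_iff _).mp hunit, one_pow]

lemma mem_of_root_of_isUnit_leadingCoeff {p : O[X]} (hp : IsUnit p.leadingCoeff) {θ : L}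
    (hθ : (p.map O.subtype).eval θ = 0) : θ ∈ O := by
  obtain ⟨q, hq⟩ := hp.exists_left_inv
  have hint : IsIntegral O θ := by
    refine ⟨C q * p, monic_C_mul_of_mul_leadingCoeff_eq_one hq, ?_⟩
    rw [eval₂_mul, ← eval_map (p := p)]
    exact mul_eq_zero_of_right _ hθ
  obtain ⟨y, hy⟩ := IsIntegrallyClosed.isIntegral_iff.mp hint
  exact hy ▸ y.2

end Valuation

section Binomial

variable {R S : Type*} [CommRing R] [CommRing S]

/-- The polynomial `(x₀ + x₁ t) ^ a - α (y₀ + y₁ t) ^ b` in `t`. -/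
noncomputable def linearBinomial (x₀ x₁ y₀ y₁ α : R) (a b : ℕ) : R[X] :=
  (C x₀ + C x₁ * X) ^ a - C α * (C y₀ + C y₁ * X) ^ b

lemma map_linearBinomial (f : R →+* S) (x₀ x₁ y₀ y₁ α : R) (a b : ℕ) :
    (linearBinomial x₀ x₁ y₀ y₁ α a b).map f =
      linearBinomial (f x₀) (f x₁) (f y₀) (f y₁) (f α) a b := by
  simp [linearBinomial]

lemma eval_linearBinomial (x₀ x₁ y₀ y₁ α t : R) (a b : ℕ) :
    (linearBinomial x₀ x₁ y₀ y₁ α a b).eval t =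
      (x₀ + x₁ * t) ^ a - α * (y₀ + y₁ * t) ^ b := by
  simp [linearBinomial]

lemma natDegree_linear_pow_le (x y : R) (n : ℕ) : ((C x + C y * X) ^ n).natDegree ≤ n := by
  refine natDegree_pow_le.trans ?_
  have : (C x + C y * X).natDegree ≤ 1 := by compute_degree
  nlinarith

lemma coeff_linear_pow (x y : R) {n m : ℕ} (h : n ≤ m) :
    ((C x + C y * X) ^ n).coeff m = if n = m then y ^ n else 0 := by
  split_ifs with h'
  · subst h'
    have h1 : (C x + C y * X).natDegree ≤ 1 := by compute_degree
    simpa using coeff_pow_of_natDegree_le (m := n) h1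
  · exact coeff_eq_zero_of_natDegree_lt ((natDegree_linear_pow_le x y n).trans_lt (by omega))

lemma natDegree_linearBinomial_le (x₀ x₁ y₀ y₁ α : R) (a b : ℕ) :
    (linearBinomial x₀ x₁ y₀ y₁ α a b).natDegree ≤ max a b := by
  refine (natDegree_sub_le _ _).trans (max_le_max (natDegree_linear_pow_le _ _ _) ?_)
  exact (natDegree_C_mul_le _ _).trans (natDegree_linear_pow_le _ _ _)

lemma coeff_max_linearBinomial (x₀ x₁ y₀ y₁ α : R) (a b : ℕ) :
    (linearBinomial x₀ x₁ y₀ y₁ α a b).coeff (max a b) =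
      (if a = max a b then x₁ ^ a else 0) - α * (if b = max a b then y₁ ^ b else 0) := by
  rw [linearBinomial, coeff_sub, coeff_C_mul, coeff_linear_pow _ _ (le_max_left a b),
    coeff_linear_pow _ _ (le_max_right a b)]

end Binomial

/-- The value of the resultant of two binomials at a valuation centred on the bracket. -/
lemma valuation_resultant_linearBinomial {L : Type*} [Field L] [IsAlgClosed L]
    (O : ValuationSubring L) {a b c d : ℕ} (ha : 0 < a) (hb : 0 < b) (h : b * c < a * d)
    {x₀ x₁ y₀ y₁ α β : O} (hy : IsUnit y₁) (hα : IsUnit α) (hβ : IsUnit β)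
    (hD : ¬ IsUnit (x₀ * y₁ - x₁ * y₀)) (hD0 : x₀ * y₁ - x₁ * y₀ ≠ 0)
    (hind : IsUnit (x₁ ^ (a * d - b * c) * (α ^ c * β ^ b) -
      y₁ ^ (a * d - b * c) * (α ^ d * β ^ a)))
    (hlead : IsUnit ((linearBinomial x₀ x₁ y₀ y₁ α a b).coeff (max a b))) :
    O.valuation (resultant (linearBinomial x₀ x₁ y₀ y₁ α a b)
      (linearBinomial x₀ x₁ y₀ y₁ β c d) (max a b) (max c d) : O) =
      O.valuation (x₀ * y₁ - x₁ * y₀ : O) ^ (b * c) := by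
  set F := linearBinomial x₀ x₁ y₀ y₁ α a b with hF
  set G := linearBinomial x₀ x₁ y₀ y₁ β c d with hG
  set v := O.valuation
  have hdeg : F.natDegree = max a b :=
    le_antisymm (natDegree_linearBinomial_le ..) (le_natDegree_of_ne_zero hlead.ne_zero)
  have hlc : IsUnit F.leadingCoeff := by rwa [leadingCoeff, hdeg]
  have hinj : Function.Injective O.subtype := O.subtype_injective
  set f := F.map O.subtype with hf
  set g := G.map O.subtype with hg
  have hfdeg : f.natDegree = max a b := by rw [hf, natDegree_map_eq_of_injective hinj, hdeg]
  have hflc : v f.leadingCoeff = 1 := by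
    rw [hf, leadingCoeff_map_of_injective hinj]
    exact (O.valuation_eq_one_iff _).mp hlc
  have hgdeg : g.natDegree ≤ max c d := natDegree_map_le.trans (natDegree_linearBinomial_le ..)
  have hsplit : f.Splits := IsAlgClosed.splits f
  have hvy : v (y₁ : L) = 1 := (O.valuation_eq_one_iff _).mp hy
  have hy0 : (y₁ : L) ≠ 0 := by
    intro h0
    simp [h0] at hvy
  have hres : v ((resultant F G (max a b) (max c d) : O) : L) =
      (f.roots.map fun θ => v (g.eval θ)).prod := by
    have h1 : ((resultant F G (max a b) (max c d) : O) : L) =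
        resultant f g f.natDegree (max c d) := by
      rw [hfdeg, hf, hg, resultant_map_map]
      rfl
    rw [h1, resultant_eq_prod_eval f g _ hgdeg hsplit, map_mul, map_pow, hflc, one_pow, one_mul,
      map_multiset_prod, Multiset.map_map]
    rfl
  have hprod : (f.roots.map fun θ => v ((y₀ : L) + y₁ * θ)).prod =
      v ((x₀ * y₁ - x₁ * y₀ : O) : L) ^ a := by
    have h1 : f.eval (-(y₀ : L) / y₁) = (((x₀ * y₁ - x₁ * y₀ : O) : L) / y₁) ^ a := by
      rw [hf, hF, map_linearBinomial, eval_linearBinomial]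
      simp only [ValuationSubring.subtype_apply]
      have e1 : (y₀ : L) + y₁ * (-(y₀ : L) / y₁) = 0 := by field_simp; ring
      have e2 : (x₀ : L) + x₁ * (-(y₀ : L) / y₁) = ((x₀ * y₁ - x₁ * y₀ : O) : L) / y₁ := by
        push_cast
        field_simp
        ring
      rw [e1, e2, zero_pow hb.ne', mul_zero, sub_zero]
    have h2 := congrArg v h1
    rw [hsplit.eq_prod_roots, eval_mul, eval_C, map_mul, hflc, one_mul, eval_multiset_prod,
      map_multiset_prod, Multiset.map_map, Multiset.map_map, map_pow, map_div₀, hvy,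
      div_one] at h2
    rw [← h2]
    congr 1
    refine Multiset.map_congr rfl fun θ _ => ?_
    simp only [Function.comp_apply, eval_sub, eval_X, eval_C]
    have : (y₀ : L) + y₁ * θ = -(y₁ * (-(y₀ : L) / y₁ - θ)) := by field_simp; ring
    rw [this, Valuation.map_neg, map_mul, hvy, one_mul]
  have hpt : ∀ θ ∈ f.roots, v (g.eval θ) ^ a = v ((y₀ : L) + y₁ * θ) ^ (b * c) := by
    intro θ hθ
    have h0 : f.eval θ = 0 := (mem_roots'.mp hθ).2
    lift θ to O using mem_of_root_of_isUnit_leadingCoeff O hlc h0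
    have e1 : (x₀ + x₁ * θ) ^ a = α * (y₀ + y₁ * θ) ^ b := by
      rw [hf, hF, map_linearBinomial, eval_linearBinomial, sub_eq_zero] at h0
      exact hinj (by simpa using h0)
    have := valuation_binomial_pow O ha hb h hα hβ hD hD0
      (u := x₀ + x₁ * θ) (w := y₀ + y₁ * θ) (by ring) hind e1
    rw [hg, hG, map_linearBinomial, eval_linearBinomial]
    simpa using this
  rw [hres]
  rw [← pow_left_inj₀ zero_le zero_le ha.ne', ← Multiset.prod_map_pow, Multiset.map_congr rfl hpt,
    Multiset.prod_map_pow, hprod, ← pow_mul, ← pow_mul, mul_comm a]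

lemma prime_bracket (K : Type*) [Field K] :
    Prime (MvPolynomial.X 0 * MvPolynomial.X 3 - MvPolynomial.X 1 * MvPolynomial.X 2 :
      MvPolynomial (Fin 4) K) := by
  rw [sub_eq_add_neg]
  refine (MvPolynomial.irreducible_mul_X_add _ _ 3 (MvPolynomial.X_ne_zero _) ?_ ?_ ?_).prime
  · simp [MvPolynomial.vars_X]
  · intro h
    rw [MvPolynomial.vars_neg] at h
    have := MvPolynomial.vars_mul _ _ h
    simp [MvPolynomial.vars_X] at this
  · have hX : Prime (MvPolynomial.X 0 : MvPolynomial (Fin 4) K) := MvPolynomial.X_prime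
    rw [hX.irreducible.isRelPrime_iff_not_dvd, dvd_neg, hX.dvd_mul, MvPolynomial.X_dvd_X,
      MvPolynomial.X_dvd_X]
    decide

end

/-- Let `K` be a field of characteristic zero, `α, β` nonzero elements of `K`, and
`a, b, c, d` positive integers with `a·d > b·c`.  In `R = K[x0, x1, y0, y1]`, consider
`F = (x0 + x1·t)^a − α·(y0 + y1·t)^b` and `G = (x0 + x1·t)^c − β·(y0 + y1·t)^d` as
polynomials in `t` with coefficients in `R`, and let `r = Res_t(F, G) ∈ R` be their
resultant.  Then `(x0·y1 − x1·y0)^{bc}` divides `r`, but `(x0·y1 − x1·y0)^{bc+1}` does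
not: the bracket `x0·y1 − x1·y0` appears with exponent exactly `b·c` in the
factorization of `r`. -/
theorem bracket_exponent_in_resultant (K : Type*) [Field K] [CharZero K]
    (α β : K) (hα : α ≠ 0) (hβ : β ≠ 0)
    (a b c d : ℕ) (ha : 0 < a) (hb : 0 < b) (hc : 0 < c) (hd : 0 < d)
    (habcd : b * c < a * d) :
    (MvPolynomial.X 0 * MvPolynomial.X 3 - MvPolynomial.X 1 * MvPolynomial.X 2 :
        MvPolynomial (Fin 4) K) ^ (b * c) ∣
      sylvesterResultant (max a b) (max c d)
        ((C (MvPolynomial.X 0) + C (MvPolynomial.X 1) * X) ^ a -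
          C (MvPolynomial.C α) * (C (MvPolynomial.X 2) + C (MvPolynomial.X 3) * X) ^ b)
        ((C (MvPolynomial.X 0) + C (MvPolynomial.X 1) * X) ^ c -
          C (MvPolynomial.C β) * (C (MvPolynomial.X 2) + C (MvPolynomial.X 3) * X) ^ d) ∧
    ¬ ((MvPolynomial.X 0 * MvPolynomial.X 3 - MvPolynomial.X 1 * MvPolynomial.X 2 :
        MvPolynomial (Fin 4) K) ^ (b * c + 1) ∣
      sylvesterResultant (max a b) (max c d)
        ((C (MvPolynomial.X 0) + C (MvPolynomial.X 1) * X) ^ a -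
          C (MvPolynomial.C α) * (C (MvPolynomial.X 2) + C (MvPolynomial.X 3) * X) ^ b)
        ((C (MvPolynomial.X 0) + C (MvPolynomial.X 1) * X) ^ c -
          C (MvPolynomial.C β) * (C (MvPolynomial.X 2) + C (MvPolynomial.X 3) * X) ^ d)) := by
  set D : MvPolynomial (Fin 4) K :=
    MvPolynomial.X 0 * MvPolynomial.X 3 - MvPolynomial.X 1 * MvPolynomial.X 2 with hDdef
  have hDp : Prime D := prime_bracket K
  let F : (MvPolynomial (Fin 4) K)[X] := linearBinomial (MvPolynomial.X 0) (MvPolynomial.X 1)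
    (MvPolynomial.X 2) (MvPolynomial.X 3) (MvPolynomial.C α) a b
  let G : (MvPolynomial (Fin 4) K)[X] := linearBinomial (MvPolynomial.X 0) (MvPolynomial.X 1)
    (MvPolynomial.X 2) (MvPolynomial.X 3) (MvPolynomial.C β) c d
  change D ^ (b * c) ∣ sylvesterResultant (max a b) (max c d) F G ∧
    ¬ D ^ (b * c + 1) ∣ sylvesterResultant (max a b) (max c d) F G
  rw [sylvesterResultant_eq_resultant _ _ _ _ (natDegree_linearBinomial_le ..)
    (natDegree_linearBinomial_le ..), resultant_comm]
  have hsign : IsUnit ((-1 : MvPolynomial (Fin 4) K) ^ (max c d * max a b)) :=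
    (isUnit_one.neg).pow _
  rw [hsign.dvd_mul_left, hsign.dvd_mul_left]
  set r := resultant F G (max a b) (max c d) with hr
  let L := AlgebraicClosure (FractionRing (MvPolynomial (Fin 4) K))
  have hι : Function.Injective (algebraMap (MvPolynomial (Fin 4) K) L) :=
    (FaithfulSMul.algebraMap_injective (FractionRing (MvPolynomial (Fin 4) K)) L).comp
      (IsFractionRing.injective (MvPolynomial (Fin 4) K) (FractionRing (MvPolynomial (Fin 4) K)))
  have : (Ideal.span {D}).IsPrime := (Ideal.span_singleton_prime hDp.ne_zero).mpr hDp
  obtain ⟨O, φ, hφ, hunit⟩ := exists_valuationSubring_center _ hι (Ideal.span {D})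
  simp only [Ideal.mem_span_singleton] at hunit
  have hφ0 : ∀ p, p ≠ 0 → φ p ≠ 0 := fun p hp h0 => hp <| hι <| by
    rw [← hφ, h0, map_zero]; rfl
  have hspec : ∀ (s : Fin 4 → K) (p : MvPolynomial (Fin 4) K), MvPolynomial.eval s D = 0 →
      MvPolynomial.eval s p ≠ 0 → IsUnit (φ p) := by
    rintro s p hs hp
    rw [hunit]
    rintro ⟨q, rfl⟩
    exact hp (by rw [map_mul, hs, zero_mul])
  have hC : ∀ x : K, x ≠ 0 → IsUnit (φ (MvPolynomial.C x)) := fun x hx =>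
    ((isUnit_iff_ne_zero.mpr hx).map MvPolynomial.C).map φ
  have hφD : φ D = φ (MvPolynomial.X 0) * φ (MvPolynomial.X 3) -
      φ (MvPolynomial.X 1) * φ (MvPolynomial.X 2) := by simp [hDdef]
  have hDu : ¬ IsUnit (φ D) := by simp [hunit]
  have hval : O.valuation (φ r : L) = O.valuation (φ D : L) ^ (b * c) := by
    rw [hr, ← resultant_map_map, map_linearBinomial, map_linearBinomial, hφD]
    refine valuation_resultant_linearBinomial O ha hb habcd ?_ (hC α hα) (hC β hβ)
      (hφD ▸ hDu) (hφD ▸ hφ0 _ hDp.ne_zero) ?_ ?_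
    · exact hspec ![0, 0, 0, 1] _ (by simp [hDdef]) (by simp)
    · simp only [← map_pow, ← map_mul, ← map_sub]
      refine hspec ![0, 1, 0, 0] _ (by simp [hDdef]) ?_
      simp [hα, hβ, (Nat.sub_pos_of_lt habcd).ne']
    · rw [← map_linearBinomial, coeff_map, coeff_max_linearBinomial]
      rcases le_or_gt b a with hab | hab
      · refine hspec ![0, 1, 0, 0] _ (by simp [hDdef]) ?_
        simp [hab, hb.ne', apply_ite]
      · refine hspec ![0, 0, 0, 1] _ (by simp [hDdef]) ?_
        simp [hab.le, ha.ne', apply_ite, hα]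
  have hv0 : 0 < O.valuation (φ D : L) := by
    rw [Valuation.pos_iff]
    simpa using hφ0 _ hDp.ne_zero
  have hr0 : r ≠ 0 := by
    intro h0
    rw [h0] at hval
    simpa using hval.trans_ne (pow_pos hv0 _).ne'
  obtain ⟨k, q, hq, hrq⟩ := WfDvdMonoid.max_power_factor hr0 hDp.irreducible
  have hk : k = b * c := by
    rw [hrq, map_mul, map_pow] at hval
    have hvq := (O.valuation_eq_one_iff _).mp ((hunit q).mpr hq)
    refine pow_right_injective₀ hv0 (fun h1 => hDu ((O.valuation_eq_one_iff _).mpr h1)) ?_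
    simpa [hvq] using hval
  rw [hrq, hk]
  refine ⟨dvd_mul_right _ _, fun hdvd => hq ?_⟩
  rw [pow_succ] at hdvd
  exact (mul_dvd_mul_iff_left (pow_ne_zero _ hDp.ne_zero)).mp hdvd
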